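/- arXiv:1005.1418 — 7 statements merged into one kernel-verified Lean document; each statement's English description precedes it below -/
import Mathlib

section
/- Let n be a natural number, let f : (Fin n → ℝ) → ℝ be Lebesgue integrable, and let x₀, a, b : Fin n → ℝ satisfy x₀ i ≤ a i ≤ b i for every i. Define the antiderivative F(x) = ∫_{Set.Icc x₀ x} f dμ, where μ is Lebesgue measure on ℝⁿ. Then ∫_{Set.Icc a b} f dμ = Σ_{S ⊆ Fin n} (−1)^{n − |S|} F(c_S), where c_S : Fin n → ℝ is the corner defined by c_S(i) = b i if i ∈ S and c_S(i) = a i otherwise. -/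
open MeasureTheory Finset

/-- The indicator function of a product of sets is the product of the indicator functions. -/
lemma indicator_univ_pi_eq_prod {ι : Type*} [Fintype ι] {α : ι → Type*} (s : ∀ i, Set (α i))
    (f : (∀ i, α i) → ℝ) (x : ∀ i, α i) :
    (Set.univ.pi s).indicator f x = (∏ i, (s i).indicator (fun _ => (1 : ℝ)) (x i)) * f x := by
  classical
  by_cases hx : x ∈ Set.univ.pi s
  · rw [Set.indicator_of_mem hx, prod_eq_one, one_mul]
    exact fun i _ => Set.indicator_of_mem (hx i trivial) _
  · obtain ⟨i, hi⟩ : ∃ i, x i ∉ s i := by simpa [Set.mem_univ_pi] using hx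
    rw [Set.indicator_of_notMem hx, prod_eq_zero (mem_univ i) (Set.indicator_of_notMem hi _),
      zero_mul]

lemma prod_sub_eq_sum_ite {ι : Type*} [Fintype ι] [DecidableEq ι] (u v : ι → ℝ) :
    ∏ i, (u i - v i) =
      ∑ S : Finset ι, (-1 : ℝ) ^ (Fintype.card ι - S.card) *
        ∏ i, if i ∈ S then u i else v i := by
  simp_rw [sub_eq_add_neg]
  rw [prod_add, powerset_univ]
  refine sum_congr rfl fun S _ => ?_
  rw [prod_neg, card_univ_sdiff, prod_ite, filter_mem_eq_inter, univ_inter, filter_notMem_eq_sdiff]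
  ring

lemma indicator_Ioc_eq_sub {x a b : ℝ} (hxa : x ≤ a) (hab : a ≤ b) (t : ℝ) :
    (Set.Ioc a b).indicator (fun _ => (1 : ℝ)) t =
      (Set.Ioc x b).indicator (fun _ => (1 : ℝ)) t -
        (Set.Ioc x a).indicator (fun _ => (1 : ℝ)) t := by
  simp only [Set.indicator_apply, Set.mem_Ioc]
  grind

lemma setIntegral_Icc_eq_integral_indicator_pi_Ioc {ι : Type*} [Fintype ι] (a b : ι → ℝ)
    (f : (ι → ℝ) → ℝ) :
    ∫ x in Set.Icc a b, f x =
      ∫ x, (Set.univ.pi fun i => Set.Ioc (a i) (b i)).indicator f x := by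
  rw [integral_indicator (MeasurableSet.univ_pi fun _ => measurableSet_Ioc), volume_pi,
    setIntegral_congr_set Measure.univ_pi_Ioc_ae_eq_Icc]

/-- The `n`-dimensional Antiderivative Theorem for a single axis-aligned box:
with `F x = ∫_{Icc x₀ x} f`, the integral of an integrable `f` over `Icc a b`
equals the inclusion–exclusion alternating sum of `F` over the 2ⁿ corners. -/
theorem antiderivative_theorem_dim_n (n : ℕ) (f : (Fin n → ℝ) → ℝ)
    (hf : Integrable f (volume : Measure (Fin n → ℝ)))
    (x₀ a b : Fin n → ℝ) (hx₀a : ∀ i, x₀ i ≤ a i) (hab : ∀ i, a i ≤ b i) :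
    (∫ x in Set.Icc a b, f x) =
      ∑ S : Finset (Fin n), (-1 : ℝ) ^ (n - S.card) *
        ∫ x in Set.Icc x₀ (fun i => if i ∈ S then b i else a i), f x := by
  simp_rw [setIntegral_Icc_eq_integral_indicator_pi_Ioc, ← integral_const_mul]
  rw [← integral_finsetSum]
  · refine integral_congr_ae (.of_forall fun x => ?_)
    simp only [indicator_univ_pi_eq_prod, indicator_Ioc_eq_sub (hx₀a _) (hab _),
      prod_sub_eq_sum_ite, Fintype.card_fin, sum_mul]
    refine sum_congr rfl fun S _ => ?_
    rw [mul_assoc]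
    congr! 3 with i
    split_ifs <;> rfl
  · exact fun S _ =>
      (hf.indicator (MeasurableSet.univ_pi fun _ => measurableSet_Ioc)).const_mul _
end

section
/- Let f : ℝ → ℝ, let φ : ℝ → ℝ be strictly monotone increasing and continuous at a point s₀, and set t₀ = φ(s₀). If the right detachment f₊^;(t₀) exists and equals d, then the right detachment of f ∘ φ at s₀ exists and equals d; similarly, if the left detachment f₋^;(t₀) exists and equals d, then the left detachment of f ∘ φ at s₀ exists and equals d. In particular, the one-sided detachments of the coordinate functions of a curve are independent of the curve's (orientation-preserving) parametrization. -/
/-- `HasRightDetachment f x d` means the right detachment `f₊^;(x)` exists and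
equals `d`, i.e. `sgn (f (x + h) - f x) → d` as `h → 0⁺`. -/
def HasRightDetachment (f : ℝ → ℝ) (x d : ℝ) : Prop :=
  Filter.Tendsto (fun h : ℝ => Real.sign (f (x + h) - f x))
    (nhdsWithin 0 (Set.Ioi 0)) (nhds d)

/-- `HasLeftDetachment f x d` means the left detachment `f₋^;(x)` exists and
equals `d`, i.e. `sgn (f (x + h) - f x) → d` as `h → 0⁻`. -/
def HasLeftDetachment (f : ℝ → ℝ) (x d : ℝ) : Prop :=
  Filter.Tendsto (fun h : ℝ => Real.sign (f (x + h) - f x))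
    (nhdsWithin 0 (Set.Iio 0)) (nhds d)

/-- `f` is tendable at `x` if both one-sided detachments exist. -/
def TendableAt (f : ℝ → ℝ) (x : ℝ) : Prop :=
  (∃ dp, HasRightDetachment f x dp) ∧ (∃ dm, HasLeftDetachment f x dm)

/-- `HasTendency f x t` means both one-sided detachments of `f` at `x` exist and
the tendency `τ_f(x) = sgn (f₊^;(x) - f₋^;(x))` equals `t`.  (Since limits in ℝ
are unique, this determines `t` uniquely whenever `f` is tendable at `x`.) -/
def HasTendency (f : ℝ → ℝ) (x t : ℝ) : Prop :=
  ∃ dp dm, HasRightDetachment f x dp ∧ HasLeftDetachment f x dm ∧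
    Real.sign (dp - dm) = t

/-- If `φ` is continuous at `x` and its increments along `s` lie in `t`, then these increments
tend to `0` within `t` as `h` tends to `0` within `s`. -/
theorem tendsto_increment_nhdsWithin {φ : ℝ → ℝ} {x : ℝ} (hcont : ContinuousAt φ x)
    {s t : Set ℝ} (hst : ∀ h ∈ s, φ (x + h) - φ x ∈ t) :
    Filter.Tendsto (fun h : ℝ => φ (x + h) - φ x) (nhdsWithin 0 s) (nhdsWithin 0 t) := by
  refine tendsto_nhdsWithin_iff.2 ⟨?_, Filter.eventually_of_mem self_mem_nhdsWithin hst⟩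
  have hx : Filter.Tendsto (fun h : ℝ => x + h) (nhds 0) (nhds x) := by
    simpa using (continuous_const_add x).tendsto 0
  simpa using ((hcont.tendsto.comp hx).sub_const (φ x)).mono_left nhdsWithin_le_nhds

/-- The one-sided detachments are invariant under an orientation-preserving
reparametrization: if `φ` is strictly increasing and continuous at `s₀`, the
one-sided detachments of `f ∘ φ` at `s₀` coincide with those of `f` at `φ s₀`. -/
theorem detachment_reparametrization_invariant (f φ : ℝ → ℝ) (hφ : StrictMono φ)
    (s₀ : ℝ) (hcont : ContinuousAt φ s₀) (t₀ : ℝ) (ht₀ : t₀ = φ s₀) (d : ℝ) :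
    (HasRightDetachment f t₀ d → HasRightDetachment (f ∘ φ) s₀ d) ∧
    (HasLeftDetachment f t₀ d → HasLeftDetachment (f ∘ φ) s₀ d) := by
  subst ht₀
  refine ⟨fun hf => ?_, fun hf => ?_⟩
  · have hinc := tendsto_increment_nhdsWithin hcont (s := Set.Ioi 0) (t := Set.Ioi 0)
      fun h hh => sub_pos.2 (hφ (lt_add_of_pos_right s₀ hh))
    simpa [HasRightDetachment, Function.comp_def] using Filter.Tendsto.comp hf hinc
  · have hinc := tendsto_increment_nhdsWithin hcont (s := Set.Iio 0) (t := Set.Iio 0)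
      fun h hh => sub_neg.2 (hφ (add_lt_of_neg_right s₀ hh))
    simpa [HasLeftDetachment, Function.comp_def] using Filter.Tendsto.comp hf hinc
end

section
/- Let f : ℝ → ℝ be differentiable at x₀ with f'(x₀) ≠ 0. Then f is tendable at x₀, with f₊^;(x₀) = sgn(f'(x₀)), f₋^;(x₀) = −sgn(f'(x₀)), and consequently the tendency satisfies τ_f(x₀) = sgn(f'(x₀)). -/
theorem Real.sign_mul_of_pos_left {a : ℝ} (ha : 0 < a) (b : ℝ) :
    Real.sign (a * b) = Real.sign b := by
  rcases lt_trichotomy b 0 with hb | rfl | hb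
  · rw [Real.sign_of_neg hb, Real.sign_of_neg (mul_neg_of_pos_of_neg ha hb)]
  · rw [mul_zero]
  · rw [Real.sign_of_pos hb, Real.sign_of_pos (mul_pos ha hb)]

theorem Filter.Tendsto.eventually_sign_eq {α : Type*} {l : Filter α} {u : α → ℝ} {d : ℝ}
    (hu : Filter.Tendsto u l (nhds d)) (hd : d ≠ 0) :
    ∀ᶠ t in l, Real.sign (u t) = Real.sign d := by
  rcases hd.lt_or_gt with hd | hd
  · filter_upwards [hu.eventually_lt_const hd] with t ht
    rw [Real.sign_of_neg ht, Real.sign_of_neg hd]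
  · filter_upwards [hu.eventually_const_lt hd] with t ht
    rw [Real.sign_of_pos ht, Real.sign_of_pos hd]

theorem HasDerivAt.hasRightDetachment {f : ℝ → ℝ} {x d : ℝ} (hf : HasDerivAt f d x)
    (hd : d ≠ 0) : HasRightDetachment f x (Real.sign d) := by
  refine tendsto_nhds_of_eventually_eq ?_
  filter_upwards [hf.tendsto_slope_zero_right.eventually_sign_eq hd, self_mem_nhdsWithin]
    with t ht ht0
  rwa [smul_eq_mul, Real.sign_mul_of_pos_left (inv_pos.2 ht0)] at ht

theorem HasDerivAt.hasLeftDetachment {f : ℝ → ℝ} {x d : ℝ} (hf : HasDerivAt f d x)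
    (hd : d ≠ 0) : HasLeftDetachment f x (-Real.sign d) := by
  refine tendsto_nhds_of_eventually_eq ?_
  filter_upwards [hf.tendsto_slope_zero_left.eventually_sign_eq hd, self_mem_nhdsWithin]
    with t ht ht0
  rw [← ht, smul_eq_mul, ← neg_mul_neg,
    Real.sign_mul_of_pos_left (neg_pos.2 (inv_lt_zero.2 ht0)), Real.sign_neg, neg_neg]

/-- If `f` is differentiable at `x₀` with nonzero derivative, then `f` is
tendable at `x₀`, with `f₊^;(x₀) = sgn (f' x₀)`, `f₋^;(x₀) = -sgn (f' x₀)`, and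
the tendency is `τ_f(x₀) = sgn (f' x₀)`. -/
theorem tendency_of_hasDerivAt (f : ℝ → ℝ) (x₀ d : ℝ)
    (hf : HasDerivAt f d x₀) (hd : d ≠ 0) :
    HasRightDetachment f x₀ (Real.sign d) ∧
    HasLeftDetachment f x₀ (-Real.sign d) ∧
    TendableAt f x₀ ∧
    HasTendency f x₀ (Real.sign d) := by
  have hr := hf.hasRightDetachment hd
  have hl := hf.hasLeftDetachment hd
  refine ⟨hr, hl, ⟨⟨_, hr⟩, ⟨_, hl⟩⟩, _, _, hr, hl, ?_⟩
  rcases hd.lt_or_gt with hd | hd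
  · rw [Real.sign_of_neg hd, Real.sign_of_neg (by norm_num)]
  · rw [Real.sign_of_pos hd, Real.sign_of_pos (by norm_num)]
end

section
/- (Trend value theorem, semi-discrete analogue of the mean value theorem.) Let a < b and let f : ℝ → ℝ be continuous on [a,b] and tendable at every point of (a,b), with f(a) ≠ f(b). Then for every value v strictly between f(a) and f(b) there exists a point c ∈ (a,b) with f(c) = v and τ_f(c) = sgn(f(b) − f(a)). -/
theorem HasRightDetachment.neg {f : ℝ → ℝ} {x d : ℝ} (h : HasRightDetachment f x d) :
    HasRightDetachment (fun y => -f y) x (-d) := by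
  refine (Filter.Tendsto.neg h).congr fun y => ?_
  rw [← Real.sign_neg]
  ring_nf

theorem HasLeftDetachment.neg {f : ℝ → ℝ} {x d : ℝ} (h : HasLeftDetachment f x d) :
    HasLeftDetachment (fun y => -f y) x (-d) := by
  refine (Filter.Tendsto.neg h).congr fun y => ?_
  rw [← Real.sign_neg]
  ring_nf

theorem TendableAt.neg {f : ℝ → ℝ} {x : ℝ} (h : TendableAt f x) :
    TendableAt (fun y => -f y) x :=
  ⟨h.1.imp' _ fun _ => HasRightDetachment.neg, h.2.imp' _ fun _ => HasLeftDetachment.neg⟩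

theorem HasTendency.neg {f : ℝ → ℝ} {x t : ℝ} (h : HasTendency f x t) :
    HasTendency (fun y => -f y) x (-t) := by
  obtain ⟨dp, dm, hp, hm, rfl⟩ := h
  refine ⟨-dp, -dm, hp.neg, hm.neg, ?_⟩
  rw [← Real.sign_neg]
  ring_nf

/-- A right detachment is nonnegative if `f` stays at or above `f x` just to the right of `x`. -/
theorem HasRightDetachment.nonneg {f : ℝ → ℝ} {x y d : ℝ} (h : HasRightDetachment f x d)
    (hxy : x < y) (hf : ∀ z ∈ Set.Ioo x y, f x ≤ f z) : 0 ≤ d := by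
  refine ge_of_tendsto h ?_
  filter_upwards [Ioo_mem_nhdsGT (sub_pos.2 hxy)] with t ht
  have hle : f x ≤ f (x + t) := hf _ ⟨by linarith [ht.1], by linarith [ht.2]⟩
  rcases hle.eq_or_lt with heq | hlt
  · rw [heq, sub_self, Real.sign_zero]
  · rw [Real.sign_of_pos (sub_pos.2 hlt)]
    exact zero_le_one

/-- A left detachment is `-1` if `f` takes values below `f x` arbitrarily close to the left
of `x`. -/
theorem HasLeftDetachment.eq_neg_one {f : ℝ → ℝ} {x d : ℝ} (h : HasLeftDetachment f x d)
    (hf : ∀ y < x, ∃ z ∈ Set.Ioo y x, f z < f x) : d = -1 := by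
  refine (isClosed_singleton (x := (-1 : ℝ))).mem_of_frequently_of_tendsto ?_ h
  rw [(nhdsLT_basis (0 : ℝ)).frequently_iff]
  intro ε hε
  obtain ⟨z, hz, hfz⟩ := hf (x + ε) (by linarith)
  refine ⟨z - x, ⟨by linarith [hz.1], by linarith [hz.2]⟩, ?_⟩
  rw [add_sub_cancel]
  exact Real.sign_of_neg (sub_neg.2 hfz)

/-- The point where the values of `f` below `v` end is an upward crossing of `v`. -/
theorem exists_hasTendency_one {a b v : ℝ} {f : ℝ → ℝ} (hab : a < b)
    (hcont : ContinuousOn f (Set.Icc a b)) (htend : ∀ x ∈ Set.Ioo a b, TendableAt f x)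
    (hav : f a < v) (hvb : v < f b) :
    ∃ c ∈ Set.Ioo a b, f c = v ∧ HasTendency f c 1 := by
  set S : Set ℝ := {x ∈ Set.Icc a b | f x < v}
  have haS : a ∈ S := ⟨Set.left_mem_Icc.2 hab.le, hav⟩
  have hlub : IsLUB S (sSup S) := isLUB_csSup ⟨a, haS⟩ ⟨b, fun x hx => hx.1.2⟩
  set c := sSup S
  have hc : c ∈ Set.Icc a b := ⟨hlub.1 haS, hlub.2 fun x hx => hx.1.2⟩
  have hright : ∀ z ∈ Set.Ioc c b, v ≤ f z := fun z hz => by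
    by_contra! hlt
    exact hz.1.not_ge (hlub.1 ⟨⟨hc.1.trans hz.1.le, hz.2⟩, hlt⟩)
  have hle : f c ≤ v := by
    have hmem : c ∈ closure S := hlub.mem_closure ⟨a, haS⟩
    have hsub : S ⊆ Set.Icc a b ∩ f ⁻¹' Set.Iic v := fun x hx => ⟨hx.1, hx.2.le⟩
    exact (closure_minimal hsub
      (hcont.preimage_isClosed_of_isClosed isClosed_Icc isClosed_Iic) hmem).2
  have hcb : c < b := hc.2.lt_of_ne fun h => (h ▸ hle).not_gt hvb
  have hge : v ≤ f c := by
    have hmem : c ∈ closure (Set.Ioc c b) := by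
      rw [closure_Ioc hcb.ne]
      exact Set.left_mem_Icc.2 hcb.le
    have hsub : Set.Ioc c b ⊆ Set.Icc a b ∩ f ⁻¹' Set.Ici v := fun x hx =>
      ⟨⟨hc.1.trans hx.1.le, hx.2⟩, hright x hx⟩
    exact (closure_minimal hsub
      (hcont.preimage_isClosed_of_isClosed isClosed_Icc isClosed_Ici) hmem).2
  have hfc : f c = v := hle.antisymm hge
  have hac : a < c := hc.1.lt_of_ne fun h => (h ▸ hge).not_gt hav
  obtain ⟨⟨dp, hp⟩, ⟨dm, hm⟩⟩ := htend c ⟨hac, hcb⟩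
  have hdp : 0 ≤ dp := hp.nonneg hcb fun z hz => hfc ▸ hright z ⟨hz.1, hz.2.le⟩
  have hdm : dm = -1 := hm.eq_neg_one fun y hy => by
    obtain ⟨z, hz, hyz⟩ := (lt_isLUB_iff hlub).1 hy
    have hzc : z ≠ c := fun h => hz.2.ne (h ▸ hfc)
    exact ⟨z, ⟨hyz, (hlub.1 hz).lt_of_ne hzc⟩, hfc ▸ hz.2⟩
  exact ⟨c, ⟨hac, hcb⟩, hfc, dp, dm, hp, hm, Real.sign_of_pos (by linarith)⟩

/-- Trend value theorem (semi-discrete analogue of the mean value theorem):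
if `f` is continuous on `[a, b]`, tendable on `(a, b)` and `f a ≠ f b`, then for
every `v` strictly between `f a` and `f b` there is `c ∈ (a, b)` with `f c = v`
and `τ_f(c) = sgn (f b - f a)`. -/
theorem trend_value_theorem (a b : ℝ) (hab : a < b) (f : ℝ → ℝ)
    (hcont : ContinuousOn f (Set.Icc a b))
    (htend : ∀ x ∈ Set.Ioo a b, TendableAt f x)
    (hne : f a ≠ f b) :
    ∀ v ∈ Set.Ioo (min (f a) (f b)) (max (f a) (f b)),
      ∃ c ∈ Set.Ioo a b, f c = v ∧ HasTendency f c (Real.sign (f b - f a)) := by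
  intro v hv
  rcases hne.lt_or_gt with hlt | hgt
  · rw [min_eq_left hlt.le, max_eq_right hlt.le] at hv
    rw [Real.sign_of_pos (sub_pos.2 hlt)]
    exact exists_hasTendency_one hab hcont htend hv.1 hv.2
  · rw [min_eq_right hgt.le, max_eq_left hgt.le] at hv
    rw [Real.sign_of_neg (sub_neg.2 hgt)]
    obtain ⟨c, hc, hfc, hτ⟩ := exists_hasTendency_one hab hcont.neg
      (fun x hx => (htend x hx).neg) (neg_lt_neg hv.2) (neg_lt_neg hv.1)
    exact ⟨c, hc, neg_injective hfc, by simpa using hτ.neg⟩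
end

section
/- (Semi-discrete analogue of Fermat's theorem.) Let f : ℝ → ℝ and let x₀ be a strict local extremum of f, i.e., there exists δ > 0 such that either f(x) < f(x₀) for all x with 0 < |x − x₀| < δ, or f(x) > f(x₀) for all x with 0 < |x − x₀| < δ. Then f is tendable at x₀, the two one-sided detachments of f at x₀ are equal, and τ_f(x₀) = 0. -/
/-- If the sign of `f x - f x₀` is constantly `d` on a punctured neighbourhood of `x₀`, then
both one-sided detachments of `f` at `x₀` equal `d`. -/
theorem hasDetachments_of_sign_eq {f : ℝ → ℝ} {x₀ δ d : ℝ} (hδ : 0 < δ)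
    (h : ∀ x : ℝ, 0 < |x - x₀| → |x - x₀| < δ → Real.sign (f x - f x₀) = d) :
    HasRightDetachment f x₀ d ∧ HasLeftDetachment f x₀ d := by
  have hlim : Filter.Tendsto (fun t : ℝ => Real.sign (f (x₀ + t) - f x₀))
      (nhdsWithin 0 {0}ᶜ) (nhds d) := by
    refine tendsto_const_nhds.congr' ?_
    filter_upwards [self_mem_nhdsWithin, mem_nhdsWithin_of_mem_nhds (Metric.ball_mem_nhds 0 hδ)]
      with t ht htδ
    refine (h (x₀ + t) ?_ ?_).symm
    · simpa using ht
    · simpa using htδ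
  exact ⟨hlim.mono_left (nhdsWithin_mono _ fun _ ht => ne_of_gt ht),
    hlim.mono_left (nhdsWithin_mono _ fun _ ht => ne_of_lt ht)⟩

/-- Semi-discrete analogue of Fermat's theorem: at a strict local extremum `x₀`
of `f`, the function is tendable, both one-sided detachments agree, and the
tendency vanishes: `τ_f(x₀) = 0`. -/
theorem tendency_eq_zero_at_strict_local_extremum (f : ℝ → ℝ) (x₀ : ℝ)
    (hext : ∃ δ > (0 : ℝ),
      (∀ x : ℝ, 0 < |x - x₀| → |x - x₀| < δ → f x < f x₀) ∨
      (∀ x : ℝ, 0 < |x - x₀| → |x - x₀| < δ → f x₀ < f x)) :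
    TendableAt f x₀ ∧
    (∃ d : ℝ, HasRightDetachment f x₀ d ∧ HasLeftDetachment f x₀ d) ∧
    HasTendency f x₀ 0 := by
  obtain ⟨d, hr, hl⟩ : ∃ d : ℝ, HasRightDetachment f x₀ d ∧ HasLeftDetachment f x₀ d := by
    obtain ⟨δ, hδ, hmax | hmin⟩ := hext
    · exact ⟨-1, hasDetachments_of_sign_eq hδ fun x hx hxδ =>
        Real.sign_of_neg (sub_neg.mpr (hmax x hx hxδ))⟩
    · exact ⟨1, hasDetachments_of_sign_eq hδ fun x hx hxδ =>
        Real.sign_of_pos (sub_pos.mpr (hmin x hx hxδ))⟩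
  exact ⟨⟨⟨d, hr⟩, ⟨d, hl⟩⟩, ⟨d, hr, hl⟩, ⟨d, d, hr, hl, by simp⟩⟩
end

section
/- (Semi-discrete analogue of Rolle's theorem.) Let a < b and let f : ℝ → ℝ be continuous on [a,b], tendable at every point of (a,b), and satisfy f(a) = f(b). Then there exists a point c ∈ (a,b) such that τ_f(c) = 0. -/
/-- If the sign of a function converges, it is eventually equal to its limit. -/
theorem eventually_sign_eq_of_tendsto {l : Filter ℝ} [l.NeBot] {g : ℝ → ℝ} {d : ℝ}
    (h : Filter.Tendsto (fun x => Real.sign (g x)) l (nhds d)) :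
    (d = -1 ∨ d = 0 ∨ d = 1) ∧ ∀ᶠ x in l, Real.sign (g x) = d := by
  have hd : d ∈ ({-1, 0, 1} : Set ℝ) :=
    (Set.toFinite _).isClosed.mem_of_tendsto h
      (Filter.Eventually.of_forall fun x => Real.sign_apply_eq (g x))
  refine ⟨hd, ?_⟩
  filter_upwards [h.eventually (Metric.ball_mem_nhds d one_half_pos)] with x hx
  rw [Real.dist_eq, abs_lt] at hx
  obtain ⟨hx₁, hx₂⟩ := hx
  rcases hd with rfl | rfl | rfl <;>
    rcases Real.sign_apply_eq (g x) with hs | hs | hs <;>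
    first | exact hs | linarith

theorem hasTendency_zero_of_eventually_eq {f : ℝ → ℝ} {x : ℝ}
    (h : ∀ᶠ k in nhds (0 : ℝ), f (x + k) = f x) : HasTendency f x 0 := by
  have ht : Filter.Tendsto (fun k => Real.sign (f (x + k) - f x)) (nhds 0) (nhds 0) :=
    tendsto_const_nhds.congr' (h.mono fun k hk => by simp [hk])
  exact ⟨0, 0, ht.mono_left nhdsWithin_le_nhds, ht.mono_left nhdsWithin_le_nhds, by simp⟩

/-- If `f` is constant on one side of a point of an open set `U`, then its tendency vanishes
somewhere in `U`. -/
theorem exists_hasTendency_zero_of_sign_tendsto_zero {f : ℝ → ℝ} {c : ℝ} {s U : Set ℝ}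
    (hs : IsOpen s) [(nhdsWithin (0 : ℝ) s).NeBot] (hU : IsOpen U) (hc : c ∈ U)
    (h : Filter.Tendsto (fun k => Real.sign (f (c + k) - f c)) (nhdsWithin 0 s) (nhds 0)) :
    ∃ x ∈ U, HasTendency f x 0 := by
  have hconst : ∀ᶠ k in nhdsWithin (0 : ℝ) s, f (c + k) = f c :=
    (eventually_sign_eq_of_tendsto h).2.mono fun k hk =>
      sub_eq_zero.mp (Real.sign_eq_zero_iff.mp hk)
  have hmem : ∀ᶠ k in nhdsWithin (0 : ℝ) s, c + k ∈ U := by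
    refine nhdsWithin_le_nhds ?_
    have hcont : Continuous fun k : ℝ => c + k := by fun_prop
    exact hcont.continuousAt.eventually (hU.mem_nhds (by simpa using hc))
  obtain ⟨k, ⟨hk, hkU, hks⟩, hkc⟩ :=
    ((eventually_eventually_nhdsWithin.mpr hconst).and
      (hmem.and self_mem_nhdsWithin)).and hconst |>.exists
  rw [hs.nhdsWithin_eq hks] at hk
  refine ⟨c + k, hkU, hasTendency_zero_of_eventually_eq ?_⟩
  have hcont : Continuous fun j : ℝ => k + j := by fun_prop
  have hlim : Filter.Tendsto (fun j : ℝ => k + j) (nhds 0) (nhds k) := by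
    simpa using hcont.tendsto 0
  filter_upwards [hlim.eventually hk] with j hj
  rw [add_assoc, hj, hkc]

/-- Semi-discrete analogue of Rolle's theorem: if `f` is continuous on `[a, b]`,
tendable on `(a, b)` and `f a = f b`, then `τ_f(c) = 0` at some `c ∈ (a, b)`. -/
theorem rolle_analogue_tendency (a b : ℝ) (hab : a < b) (f : ℝ → ℝ)
    (hcont : ContinuousOn f (Set.Icc a b))
    (htend : ∀ x ∈ Set.Ioo a b, TendableAt f x)
    (heq : f a = f b) :
    ∃ c ∈ Set.Ioo a b, HasTendency f c 0 := by
  obtain ⟨c, hc, hext⟩ := exists_isLocalExtr_Ioo hab hcont heq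
  obtain ⟨⟨dp, hp⟩, ⟨dm, hm⟩⟩ := htend c hc
  by_cases hp0 : dp = 0
  · subst hp0
    exact exists_hasTendency_zero_of_sign_tendsto_zero isOpen_Ioi isOpen_Ioo hc hp
  by_cases hm0 : dm = 0
  · subst hm0
    exact exists_hasTendency_zero_of_sign_tendsto_zero isOpen_Iio isOpen_Ioo hc hm
  refine ⟨c, hc, dp, dm, hp, hm, ?_⟩
  have hlim : Filter.Tendsto (fun k : ℝ => c + k) (nhds 0) (nhds c) := by
    have hadd : Continuous fun k : ℝ => c + k := by fun_prop
    simpa using hadd.tendsto 0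
  have hdp := (eventually_sign_eq_of_tendsto hp).1
  have hdm := (eventually_sign_eq_of_tendsto hm).1
  suffices dp = dm by simp [this]
  rcases hext with hmin | hmax
  · have hev : ∀ᶠ k in nhds (0 : ℝ), 0 ≤ Real.sign (f (c + k) - f c) :=
      (hlim.eventually hmin).mono fun k (hk : f c ≤ f (c + k)) => by
        unfold Real.sign; split_ifs <;> linarith
    have hp1 : 0 ≤ dp := ge_of_tendsto hp (nhdsWithin_le_nhds hev)
    have hm1 : 0 ≤ dm := ge_of_tendsto hm (nhdsWithin_le_nhds hev)
    grind
  · have hev : ∀ᶠ k in nhds (0 : ℝ), Real.sign (f (c + k) - f c) ≤ 0 :=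
      (hlim.eventually hmax).mono fun k (hk : f (c + k) ≤ f c) => by
        unfold Real.sign; split_ifs <;> linarith
    have hp1 : dp ≤ 0 := le_of_tendsto hp (nhdsWithin_le_nhds hev)
    have hm1 : dm ≤ 0 := le_of_tendsto hm (nhdsWithin_le_nhds hev)
    grind
end

section
/- Let a < b and let f : ℝ → ℝ be continuous on [a,b]. Suppose that for every x ∈ (a,b) the one-sided detachments exist with f₊^;(x) = 1 and f₋^;(x) = −1. Then f is strictly monotone increasing on [a,b], i.e., f(x) < f(y) for all a ≤ x < y ≤ b. -/
theorem HasRightDetachment.exists_lt {f : ℝ → ℝ} {x y : ℝ}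
    (h : HasRightDetachment f x 1) (hxy : x < y) : ∃ z ∈ Set.Ioo x y, f x < f z := by
  have hpos : ∀ᶠ t in nhdsWithin (0 : ℝ) (Set.Ioi 0), 0 < Real.sign (f (x + t) - f x) :=
    Filter.Tendsto.eventually_const_lt one_pos h
  obtain ⟨t, ht, ht0, hty⟩ := (hpos.and (Ioo_mem_nhdsGT (sub_pos.mpr hxy))).exists
  refine ⟨x + t, ⟨by linarith, by linarith⟩, ?_⟩
  by_contra! hle
  rcases hle.lt_or_eq with hlt | heq
  · rw [Real.sign_of_neg (sub_neg.mpr hlt)] at ht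
    linarith
  · simp [heq] at ht

theorem HasLeftDetachment.exists_lt {f : ℝ → ℝ} {x y : ℝ}
    (h : HasLeftDetachment f x (-1)) (hyx : y < x) : ∃ z ∈ Set.Ioo y x, f z < f x := by
  have hneg : ∀ᶠ t in nhdsWithin (0 : ℝ) (Set.Iio 0), Real.sign (f (x + t) - f x) < 0 :=
    Filter.Tendsto.eventually_lt_const (by norm_num) h
  obtain ⟨t, ht, hty, ht0⟩ := (hneg.and (Ioo_mem_nhdsLT (sub_neg.mpr hyx))).exists
  refine ⟨x + t, ⟨by linarith, by linarith⟩, ?_⟩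
  by_contra! hle
  rcases hle.lt_or_eq with hlt | heq
  · rw [Real.sign_of_pos (sub_pos.mpr hlt)] at ht
    linarith
  · simp [← heq] at ht

/-- A continuous function whose right detachment is `1` on `[u, v)` satisfies `f u < f v`. -/
theorem lt_of_hasRightDetachment {f : ℝ → ℝ} {u v : ℝ} (huv : u < v)
    (hcont : ContinuousOn f (Set.Icc u v))
    (hdet : ∀ x ∈ Set.Ico u v, HasRightDetachment f x 1) : f u < f v := by
  obtain ⟨c, hc, hmax⟩ :=
    isCompact_Icc.exists_isMaxOn (Set.nonempty_Icc.mpr huv.le) hcont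
  have hcv : c = v := by
    by_contra hne
    have hlt := lt_of_le_of_ne hc.2 hne
    obtain ⟨z, hz, hfz⟩ := (hdet c ⟨hc.1, hlt⟩).exists_lt hlt
    exact hfz.not_ge (hmax ⟨hc.1.trans hz.1.le, hz.2.le⟩)
  subst hcv
  obtain ⟨z, hz, hfz⟩ := (hdet u ⟨le_rfl, huv⟩).exists_lt huv
  exact hfz.trans_le (hmax ⟨hz.1.le, hz.2.le⟩)

/-- A continuous function whose left detachment is `-1` on `(u, v]` satisfies `f u < f v`. -/
theorem lt_of_hasLeftDetachment {f : ℝ → ℝ} {u v : ℝ} (huv : u < v)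
    (hcont : ContinuousOn f (Set.Icc u v))
    (hdet : ∀ x ∈ Set.Ioc u v, HasLeftDetachment f x (-1)) : f u < f v := by
  obtain ⟨c, hc, hmin⟩ :=
    isCompact_Icc.exists_isMinOn (Set.nonempty_Icc.mpr huv.le) hcont
  have hcu : c = u := by
    by_contra hne
    have hlt := lt_of_le_of_ne hc.1 (Ne.symm hne)
    obtain ⟨z, hz, hfz⟩ := (hdet c ⟨hlt, hc.2⟩).exists_lt hlt
    exact hfz.not_ge (hmin ⟨hz.1.le, hz.2.le.trans hc.2⟩)
  subst hcu
  obtain ⟨z, hz, hfz⟩ := (hdet v ⟨huv, le_rfl⟩).exists_lt huv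
  exact lt_of_le_of_lt (hmin ⟨hz.1.le, hz.2.le⟩) hfz

/-- If `f` is continuous on `[a, b]` and at every interior point the one-sided
detachments are `f₊^;(x) = 1` and `f₋^;(x) = -1` (positive instantaneous trend
of change), then `f` is strictly monotone increasing on `[a, b]`. -/
theorem strictMonoOn_of_detachments (a b : ℝ) (hab : a < b) (f : ℝ → ℝ)
    (hcont : ContinuousOn f (Set.Icc a b))
    (hdet : ∀ x ∈ Set.Ioo a b,
      HasRightDetachment f x 1 ∧ HasLeftDetachment f x (-1)) :
    ∀ x ∈ Set.Icc a b, ∀ y ∈ Set.Icc a b, x < y → f x < f y := by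
  intro x hx y hy hxy
  obtain ⟨m, hxm, hmy⟩ := exists_between hxy
  have hleft : f x < f m := lt_of_hasLeftDetachment hxm
    (hcont.mono (Set.Icc_subset_Icc hx.1 (hmy.le.trans hy.2)))
    fun t ht => (hdet t ⟨hx.1.trans_lt ht.1, (ht.2.trans_lt hmy).trans_le hy.2⟩).2
  have hright : f m < f y := lt_of_hasRightDetachment hmy
    (hcont.mono (Set.Icc_subset_Icc (hx.1.trans hxm.le) hy.2))
    fun t ht => (hdet t ⟨(hx.1.trans_lt hxm).trans_le ht.1, ht.2.trans_le hy.2⟩).1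
  exact hleft.trans hright
end
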